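/- arXiv:2210.05292 — 2 statements merged into one kernel-verified Lean document; each statement's English description precedes it below -/
import Mathlib

section
/- Let ψ be a flow on a compact metric space X, let r : X → (0,∞) be continuous, and let ψ̂ := ψ^r be the reparametrized flow. For m ∈ P(ψ) define the Borel probability measure m̂ on X by m̂(B) := (∫_B r dm)/(∫_X r dm) for Borel sets B. Then m̂ is ψ̂-invariant, and the map m ↦ m̂ is a bijection from P(ψ) onto P(ψ̂). -/
open MeasureTheory

noncomputable section

/-- `κ_r(x,t) = ∫_0^t r(ψ_s(x)) ds`, the accumulated reparametrization time. -/
def flowKappa {X : Type*} [TopologicalSpace X] (ψ : Flow ℝ X) (r : X → ℝ) (x : X) (t : ℝ) : ℝ :=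
  ∫ s in (0:ℝ)..t, r (ψ s x)

/-- `ψhat` is the reparametrization `ψ^r` of the flow `ψ` by the (positive continuous)
function `r`.  Since `κ_r(x,·)` and `α_r(x,·)` are mutually inverse increasing homeomorphisms
of `ℝ`, the defining identity `ψhat_t(x) = ψ_{α_r(x,t)}(x)` is equivalent to
`ψhat_{κ_r(x,t)}(x) = ψ_t(x)` for all `x ∈ X` and `t ∈ ℝ`. -/
def IsReparam {X : Type*} [TopologicalSpace X] (ψ : Flow ℝ X) (r : X → ℝ) (ψhat : Flow ℝ X) :
    Prop :=
  ∀ (x : X) (t : ℝ), ψhat (flowKappa ψ r x t) x = ψ t x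

/-- `P(ψ)`: the set of `ψ`-invariant Borel probability measures on `X`. -/
def flowInvProb {X : Type*} [TopologicalSpace X] [MeasurableSpace X] (ψ : Flow ℝ X) :
    Set (Measure X) :=
  {m | IsProbabilityMeasure m ∧ ∀ t : ℝ, Measure.map (ψ t) m = m}

/-- The measure `m̂` with `m̂(B) = (∫_B r dm)/(∫_X r dm)`. -/
def reparamMeasure {X : Type*} [MeasurableSpace X] (r : X → ℝ) (m : Measure X) : Measure X :=
  (ENNReal.ofReal (∫ x, r x ∂m))⁻¹ • m.withDensity (fun x => ENNReal.ofReal (r x))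

section Orbit

variable {X : Type*} [TopologicalSpace X]

theorem hasDerivAt_flowKappa (ψ : Flow ℝ X) {r : X → ℝ} (hr : Continuous r) (x : X) (t : ℝ) :
    HasDerivAt (flowKappa ψ r x) (r (ψ t x)) t := by
  have hc : Continuous fun s => r (ψ s x) := hr.comp (ψ.continuous continuous_id continuous_const)
  exact intervalIntegral.integral_hasDerivAt_right (hc.intervalIntegrable _ _)
    hc.stronglyMeasurable.stronglyMeasurableAtFilter hc.continuousAt

/-- Change of variables `u = κ_r(x,s)` along an orbit. -/
theorem IsReparam.integral_comp_mul {ψ ψhat : Flow ℝ X} {r : X → ℝ} (h : IsReparam ψ r ψhat)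
    (hr : Continuous r) {f : X → ℝ} (hf : Continuous f) (x : X) (t : ℝ) :
    ∫ s in (0 : ℝ)..t, f (ψ s x) * r (ψ s x) =
      ∫ u in (0 : ℝ)..flowKappa ψ r x t, f (ψhat u x) := by
  have hc : Continuous fun s => r (ψ s x) := hr.comp (ψ.continuous continuous_id continuous_const)
  have := intervalIntegral.integral_comp_mul_deriv (a := 0) (b := t)
    (fun s _ => hasDerivAt_flowKappa ψ hr x s) hc.continuousOn
    (hf.comp (ψhat.continuous continuous_id (continuous_const (y := x))))
  simpa only [Function.comp_def, id, h x, show flowKappa ψ r x 0 = 0 by simp [flowKappa]] using this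

/-- Shifting an observable along `ψ^r` changes its weighted orbit integrals by a bounded amount. -/
theorem IsReparam.norm_integral_shift_sub_le {ψ ψhat : Flow ℝ X} {r : X → ℝ}
    (h : IsReparam ψ r ψhat) (hr : Continuous r) {f : X → ℝ} (hf : Continuous f) {C : ℝ}
    (hC : ∀ x, ‖f x‖ ≤ C) (τ : ℝ) (x : X) (t : ℝ) :
    ‖∫ s in (0 : ℝ)..t, (f (ψhat τ (ψ s x)) - f (ψ s x)) * r (ψ s x)‖ ≤ 2 * (C * |τ|) := by
  have hc : Continuous fun u => f (ψhat u x) :=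
    hf.comp (ψhat.continuous continuous_id continuous_const)
  have hi (a b : ℝ) : IntervalIntegrable (fun u => f (ψhat u x)) volume a b :=
    hc.intervalIntegrable a b
  rw [h.integral_comp_mul hr (f := fun y => f (ψhat τ y) - f y)
    ((hf.comp (ψhat.continuous_toFun τ)).sub hf)]
  set T := flowKappa ψ r x t
  have hsub : ∫ u in (0 : ℝ)..T, (f (ψhat τ (ψhat u x)) - f (ψhat u x)) =
      (∫ u in T..(T + τ), f (ψhat u x)) - ∫ u in (0 : ℝ)..τ, f (ψhat u x) := by
    have hc' : Continuous fun u => f (ψhat (τ + u) x) := by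
      exact hc.comp (continuous_const.add continuous_id)
    simp only [← ψhat.map_add]
    rw [intervalIntegral.integral_sub (hc'.intervalIntegrable _ _) (hi _ _),
      intervalIntegral.integral_comp_add_left (fun u => f (ψhat u x)) τ, add_zero, add_comm τ T]
    linarith [intervalIntegral.integral_add_adjacent_intervals (hi 0 τ) (hi τ (T + τ)),
      intervalIntegral.integral_add_adjacent_intervals (hi 0 T) (hi T (T + τ))]
  have hb (a b : ℝ) : ‖∫ u in a..b, f (ψhat u x)‖ ≤ C * |b - a| :=
    intervalIntegral.norm_integral_le_of_norm_le_const fun u _ => hC _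
  rw [hsub]
  have h₁ := hb T (T + τ)
  have h₂ := hb 0 τ
  rw [add_sub_cancel_left] at h₁
  rw [sub_zero] at h₂
  linarith [norm_sub_le (∫ u in T..(T + τ), f (ψhat u x)) (∫ u in (0 : ℝ)..τ, f (ψhat u x))]

variable [CompactSpace X]

theorem flowKappa_surjective (ψ : Flow ℝ X) {r : X → ℝ} (hr : Continuous r)
    (hr_pos : ∀ x, 0 < r x) (x : X) : Function.Surjective (flowKappa ψ r x) := by
  obtain ⟨y, -, hy⟩ := isCompact_univ.exists_isMinOn ⟨x, Set.mem_univ x⟩ hr.continuousOn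
  have hmin (z : X) : r y ≤ r z := hy (Set.mem_univ z)
  have hd := fun t => hasDerivAt_flowKappa ψ hr x t
  have hmono : Monotone fun t => flowKappa ψ r x t - r y * t := by
    refine monotone_of_hasDerivAt_nonneg
      (fun t => (hd t).sub ((hasDerivAt_id t).const_mul (r y))) fun t => ?_
    simpa using hmin (ψ t x)
  have h0 : flowKappa ψ r x 0 = 0 := by simp [flowKappa]
  refine Continuous.surjective
    (continuous_iff_continuousAt.2 fun t => (hd t).continuousAt) ?_ ?_
  · refine Filter.tendsto_atTop_mono' _ ?_
      (Filter.tendsto_id.const_mul_atTop (hr_pos y))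
    filter_upwards [Filter.eventually_ge_atTop 0] with t ht
    have := hmono ht
    simp only [h0, mul_zero, sub_zero, id] at this ⊢
    linarith
  · refine Filter.tendsto_atBot_mono' _ ?_
      (Filter.tendsto_id.const_mul_atBot (hr_pos y))
    filter_upwards [Filter.eventually_le_atBot 0] with t ht
    have := hmono ht
    simp only [h0, mul_zero, sub_zero, id] at this ⊢
    linarith

/-- The original flow is the reparametrization of `ψ^r` by `1 / r`. -/
theorem IsReparam.symm {ψ ψhat : Flow ℝ X} {r : X → ℝ} (h : IsReparam ψ r ψhat)
    (hr : Continuous r) (hr_pos : ∀ x, 0 < r x) : IsReparam ψhat (fun x => (r x)⁻¹) ψ := by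
  intro x T
  obtain ⟨t, rfl⟩ := flowKappa_surjective ψ hr hr_pos x T
  have hκ : flowKappa ψhat (fun x => (r x)⁻¹) x (flowKappa ψ r x t) = t := by
    rw [flowKappa, ← h.integral_comp_mul hr (f := fun x => (r x)⁻¹)
      (hr.inv₀ fun x => (hr_pos x).ne')]
    simp [inv_mul_cancel₀ (hr_pos _).ne']
  rw [hκ, h]

end Orbit

section Measure

variable {X : Type*} [MetricSpace X] [MeasurableSpace X] [BorelSpace X]

theorem integral_reparamMeasure {r : X → ℝ} (hr : Continuous r) (hr_pos : ∀ x, 0 < r x)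
    (m : Measure X) (f : X → ℝ) :
    ∫ x, f x ∂(reparamMeasure r m) = (∫ x, r x ∂m)⁻¹ * ∫ x, f x * r x ∂m := by
  have h0 : 0 ≤ ∫ x, r x ∂m := integral_nonneg fun x => (hr_pos x).le
  rw [reparamMeasure, integral_smul_measure,
    integral_withDensity_eq_integral_toReal_smul hr.measurable.ennreal_ofReal
      (Filter.Eventually.of_forall fun _ => ENNReal.ofReal_lt_top),
    ENNReal.toReal_inv, ENNReal.toReal_ofReal h0, smul_eq_mul]
  congr 1
  refine integral_congr_ae (Filter.Eventually.of_forall fun x => ?_)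
  simp only [ENNReal.toReal_ofReal (hr_pos x).le, smul_eq_mul]
  ring

variable [CompactSpace X]

theorem Continuous.integrable_of_compactSpace {f : X → ℝ} (hf : Continuous f)
    (m : Measure X) [IsFiniteMeasure m] : Integrable f m :=
  hf.integrable_of_hasCompactSupport (HasCompactSupport.of_compactSpace f)

/-- A positive continuous function has positive integral against a probability measure. -/
theorem integral_pos_of_continuous_pos {r : X → ℝ} (hr : Continuous r) (hr_pos : ∀ x, 0 < r x)
    (m : Measure X) [IsProbabilityMeasure m] : 0 < ∫ x, r x ∂m := by
  rw [integral_pos_iff_support_of_nonneg (fun x => (hr_pos x).le)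
    (hr.integrable_of_compactSpace m)]
  have : Function.support r = Set.univ := Set.eq_univ_of_forall fun x => (hr_pos x).ne'
  simp [this]

theorem isProbabilityMeasure_reparamMeasure {r : X → ℝ} (hr : Continuous r)
    (hr_pos : ∀ x, 0 < r x) (m : Measure X) [IsProbabilityMeasure m] :
    IsProbabilityMeasure (reparamMeasure r m) := by
  have hpos := integral_pos_of_continuous_pos hr hr_pos m
  constructor
  rw [reparamMeasure, Measure.smul_apply, withDensity_apply _ MeasurableSet.univ,
    Measure.restrict_univ, ← ofReal_integral_eq_lintegral_ofReal (hr.integrable_of_compactSpace m)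
      (Filter.Eventually.of_forall fun x => (hr_pos x).le), smul_eq_mul]
  exact ENNReal.inv_mul_cancel (by simpa using hpos) ENNReal.ofReal_ne_top

theorem reparamMeasure_inv_reparamMeasure {r : X → ℝ} (hr : Continuous r)
    (hr_pos : ∀ x, 0 < r x) (m : Measure X) [IsProbabilityMeasure m] :
    reparamMeasure (fun x => (r x)⁻¹) (reparamMeasure r m) = m := by
  have hpos := integral_pos_of_continuous_pos hr hr_pos m
  have hi : Continuous fun x => (r x)⁻¹ := hr.inv₀ fun x => (hr_pos x).ne'
  have hi_pos : ∀ x, 0 < (r x)⁻¹ := fun x => inv_pos.2 (hr_pos x)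
  have := isProbabilityMeasure_reparamMeasure hr hr_pos m
  have := isProbabilityMeasure_reparamMeasure hi hi_pos (reparamMeasure r m)
  refine ext_of_forall_integral_eq_of_IsFiniteMeasure fun f => ?_
  have h (x : X) : (r x)⁻¹ * r x = 1 := inv_mul_cancel₀ (hr_pos x).ne'
  rw [integral_reparamMeasure hi hi_pos, integral_reparamMeasure hr hr_pos,
    integral_reparamMeasure hr hr_pos]
  simp only [mul_assoc, h, mul_one, integral_const, probReal_univ, smul_eq_mul, inv_inv]
  exact mul_inv_cancel_left₀ hpos.ne' _

/-- Fubini for the integral of an observable along the orbits of a measure-preserving flow. -/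
theorem integral_intervalIntegral_flow {ψ : Flow ℝ X} {m : Measure X} (hm : m ∈ flowInvProb ψ)
    {g : X → ℝ} (hg : Continuous g) (t : ℝ) :
    ∫ x, (∫ s in (0 : ℝ)..t, g (ψ s x)) ∂m = t * ∫ x, g x ∂m := by
  have := hm.1
  obtain ⟨C, hC⟩ := isCompact_univ.exists_bound_of_continuousOn hg.continuousOn
  have hcont : Continuous (Function.uncurry fun (s : ℝ) (x : X) => g (ψ s x)) :=
    hg.comp (ψ.continuous continuous_fst continuous_snd)
  rw [← intervalIntegral_integral_swap]
  · have h (s : ℝ) : ∫ x, g (ψ s x) ∂m = ∫ x, g x ∂m := by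
      conv_rhs => rw [← hm.2 s]
      exact (integral_map (ψ.continuous_toFun s).aemeasurable
        hg.aestronglyMeasurable).symm
    simp [h]
  · have : IsFiniteMeasure (volume.restrict (Set.uIoc 0 t)) :=
      ⟨by simp [Set.uIoc]⟩
    refine Integrable.of_bound hcont.aestronglyMeasurable C ?_
    exact Filter.Eventually.of_forall fun p => hC _ (Set.mem_univ _)

/-- The measure `m̂` is invariant under the reparametrized flow. -/
theorem IsReparam.reparamMeasure_mem {ψ ψhat : Flow ℝ X} {r : X → ℝ} (h : IsReparam ψ r ψhat)
    (hr : Continuous r) (hr_pos : ∀ x, 0 < r x) {m : Measure X} (hm : m ∈ flowInvProb ψ) :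
    reparamMeasure r m ∈ flowInvProb ψhat := by
  have := hm.1
  have hprob := isProbabilityMeasure_reparamMeasure hr hr_pos m
  refine ⟨hprob, fun τ => ?_⟩
  have hτ := ψhat.continuous_toFun τ
  have := Measure.isProbabilityMeasure_map (μ := reparamMeasure r m) hτ.aemeasurable
  refine ext_of_forall_integral_eq_of_IsFiniteMeasure fun f => ?_
  rw [integral_map hτ.aemeasurable f.continuous.aestronglyMeasurable,
    integral_reparamMeasure hr hr_pos, integral_reparamMeasure hr hr_pos]
  congr 1
  have hfτ : Continuous fun x => f (ψhat τ x) := f.continuous.comp hτ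
  set D := ∫ x, (f (ψhat τ x) - f x) * r x ∂m with hD
  have hbound (t : ℝ) : |t * D| ≤ 2 * (‖f‖ * |τ|) := by
    rw [hD, ← integral_intervalIntegral_flow hm
      (g := fun x => (f (ψhat τ x) - f x) * r x) ((hfτ.sub f.continuous).mul hr) t]
    refine (norm_integral_le_of_norm_le_const (Filter.Eventually.of_forall fun x =>
      h.norm_integral_shift_sub_le hr f.continuous f.norm_coe_le_norm τ x t)).trans ?_
    simp
  have hD0 : D = 0 := by
    by_contra hne
    have := hbound ((2 * (‖f‖ * |τ|) + 1) / D)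
    rw [div_mul_cancel₀ _ hne] at this
    linarith [le_abs_self (2 * (‖f‖ * |τ|) + 1)]
  have hi₁ : Integrable (fun x => f (ψhat τ x) * r x) m :=
    (hfτ.mul hr).integrable_of_compactSpace m
  have hi₂ : Integrable (fun x => f x * r x) m :=
    (f.continuous.mul hr).integrable_of_compactSpace m
  rw [← sub_eq_zero, ← integral_sub hi₁ hi₂, ← hD0, hD]
  simp only [sub_mul]

end Measure

/-- `m ↦ m̂` maps `P(ψ)` into `P(ψ^r)` and is a bijection from `P(ψ)` onto
`P(ψ^r)`. -/
theorem reparamMeasure_bijOn {X : Type*} [MetricSpace X] [CompactSpace X]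
    [MeasurableSpace X] [BorelSpace X]
    (ψ ψhat : Flow ℝ X) (r : X → ℝ) (hr_cont : Continuous r) (hr_pos : ∀ x, 0 < r x)
    (hψhat : IsReparam ψ r ψhat) :
    (∀ m ∈ flowInvProb ψ, reparamMeasure r m ∈ flowInvProb ψhat) ∧
      Set.BijOn (reparamMeasure r) (flowInvProb ψ) (flowInvProb ψhat) := by
  have hi : Continuous fun x => (r x)⁻¹ := hr_cont.inv₀ fun x => (hr_pos x).ne'
  have hi_pos : ∀ x, 0 < (r x)⁻¹ := fun x => inv_pos.2 (hr_pos x)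
  have hmaps : ∀ m ∈ flowInvProb ψ, reparamMeasure r m ∈ flowInvProb ψhat := fun m hm =>
    hψhat.reparamMeasure_mem hr_cont hr_pos hm
  refine ⟨hmaps, Set.InvOn.bijOn (f' := reparamMeasure fun x => (r x)⁻¹) ⟨?_, ?_⟩ hmaps ?_⟩
  · intro m hm
    have := hm.1
    exact reparamMeasure_inv_reparamMeasure hr_cont hr_pos m
  · intro m hm
    have := hm.1
    simpa only [inv_inv] using reparamMeasure_inv_reparamMeasure hi hi_pos m
  · exact fun m hm => (hψhat.symm hr_cont hr_pos).reparamMeasure_mem hi hi_pos hm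
end
end

section
/- Let ψ be a flow on a nonempty compact metric space X. Let (r_s)_{s∈(−1,1)} be a family of continuous functions X → ℝ with r_0 ≡ 1, and suppose there is a continuous function ṙ_0 : X → ℝ such that sup_{x∈X} |(r_s(x) − 1)/s − ṙ_0(x)| → 0 as s → 0. Define u(s) := sup_{m ∈ P(ψ)} ∫_X r_s dm. Then u(0) = 1 and the right derivative of u at 0 exists and equals sup_{m ∈ P(ψ)} ∫_X ṙ_0 dm, i.e. lim_{s→0⁺} (u(s) − 1)/s = sup_{m ∈ P(ψ)} ∫_X ṙ_0 dm. -/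
open MeasureTheory Filter Topology

noncomputable section

theorem Flow.mem_flowInvProb_of_integral_comp_eq {X : Type*} [MetricSpace X]
    [MeasurableSpace X] [BorelSpace X] (ψ : Flow ℝ X) (m : Measure X) [IsProbabilityMeasure m]
    (h : ∀ (t : ℝ) (f : BoundedContinuousFunction X ℝ), ∫ x, f (ψ t x) ∂m = ∫ x, f x ∂m) :
    m ∈ flowInvProb ψ := by
  refine ⟨inferInstance, fun t => ?_⟩
  have hc : Continuous (ψ t) := ψ.continuous_toFun t
  have : IsProbabilityMeasure (m.map (ψ t)) :=
    Measure.isProbabilityMeasure_map hc.measurable.aemeasurable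
  refine ext_of_forall_integral_eq_of_IsFiniteMeasure fun f => ?_
  rw [integral_map hc.measurable.aemeasurable f.continuous.aestronglyMeasurable, h t f]

/-- The uniform probability measure on the orbit segment `{ψ_t x : 0 < t ≤ n + 1}`. -/
def orbitAverage {X : Type*} [TopologicalSpace X] [MeasurableSpace X] (ψ : Flow ℝ X) (x : X)
    (n : ℕ) : Measure X :=
  ENNReal.ofReal ((n : ℝ) + 1)⁻¹ •
    (volume.restrict (Set.Ioc (0 : ℝ) (n + 1))).map (fun t => ψ t x)

theorem Flow.continuous_orbit {X : Type*} [TopologicalSpace X] (ψ : Flow ℝ X) (x : X) :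
    Continuous fun t => ψ t x :=
  ψ.continuous continuous_id continuous_const

theorem isProbabilityMeasure_orbitAverage {X : Type*} [TopologicalSpace X] [MeasurableSpace X]
    [BorelSpace X] (ψ : Flow ℝ X) (x : X) (n : ℕ) :
    IsProbabilityMeasure (orbitAverage ψ x n) := by
  constructor
  have hn : (0 : ℝ) < n + 1 := by positivity
  rw [orbitAverage, Measure.smul_apply,
    Measure.map_apply (ψ.continuous_orbit x).measurable MeasurableSet.univ]
  simp only [Set.preimage_univ, Measure.restrict_apply_univ, Real.volume_Ioc, sub_zero,
    smul_eq_mul]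
  rw [← ENNReal.ofReal_mul (by positivity), inv_mul_cancel₀ hn.ne', ENNReal.ofReal_one]

theorem integral_orbitAverage {X : Type*} [MetricSpace X] [MeasurableSpace X]
    [BorelSpace X] (ψ : Flow ℝ X) (x : X) (n : ℕ) {f : X → ℝ} (hf : Continuous f) :
    ∫ y, f y ∂(orbitAverage ψ x n) = ((n : ℝ) + 1)⁻¹ * ∫ t in (0 : ℝ)..(n + 1), f (ψ t x) := by
  have hn : (0 : ℝ) ≤ n + 1 := by positivity
  have hm := hf.measurable.stronglyMeasurable.aestronglyMeasurable
    (μ := (volume.restrict (Set.Ioc (0 : ℝ) (n + 1))).map (fun t => ψ t x))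
  rw [orbitAverage, integral_smul_measure,
    integral_map (ψ.continuous_orbit x).measurable.aemeasurable hm,
    intervalIntegral.integral_of_le hn, ENNReal.toReal_ofReal (by positivity), smul_eq_mul]

theorem abs_integral_comp_flow_orbitAverage_sub_le {X : Type*} [MetricSpace X]
    [MeasurableSpace X] [BorelSpace X] (ψ : Flow ℝ X) (x : X) (n : ℕ) (s : ℝ)
    (f : BoundedContinuousFunction X ℝ) :
    |∫ y, f (ψ s y) ∂(orbitAverage ψ x n) - ∫ y, f y ∂(orbitAverage ψ x n)| ≤
      2 * ‖f‖ * |s| * ((n : ℝ) + 1)⁻¹ := by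
  have hn : (0 : ℝ) < n + 1 := by positivity
  have hc : Continuous fun t => f (ψ t x) := f.continuous.comp (ψ.continuous_orbit x)
  have hi (a b : ℝ) : IntervalIntegrable (fun t => f (ψ t x)) volume a b :=
    hc.intervalIntegrable a b
  have hb (a b : ℝ) : |∫ t in a..b, f (ψ t x)| ≤ ‖f‖ * |b - a| :=
    intervalIntegral.norm_integral_le_of_norm_le_const fun t _ => f.norm_coe_le_norm _
  have hshift : ∫ t in (0 : ℝ)..(n + 1), f (ψ s (ψ t x)) =
      ∫ t in (0 + s)..(n + 1 + s), f (ψ t x) := by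
    rw [← intervalIntegral.integral_comp_add_right (fun t => f (ψ t x)) s]
    simp only [← ψ.map_add, add_comm]
  rw [integral_orbitAverage ψ x n (f := fun y => f (ψ s y))
      (f.continuous.comp (ψ.continuous_toFun s)),
    integral_orbitAverage ψ x n f.continuous, ← mul_sub, abs_mul,
    abs_of_pos (inv_pos.2 hn), mul_comm]
  gcongr
  have h₁ := hb (n + 1) (n + 1 + s)
  have h₂ := hb 0 (0 + s)
  have h₃ := intervalIntegral.integral_add_adjacent_intervals (hi 0 (0 + s)) (hi _ (n + 1 + s))
  have h₄ := intervalIntegral.integral_add_adjacent_intervals (hi 0 (n + 1)) (hi _ (n + 1 + s))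
  simp only [add_sub_cancel_left] at h₁ h₂
  rw [abs_le] at h₁ h₂
  rw [hshift, abs_le]
  constructor <;> linarith

/-- The **Krylov–Bogolyubov theorem** for flows on compact metric spaces. -/
theorem flowInvProb_nonempty {X : Type*} [MetricSpace X] [CompactSpace X] [Nonempty X]
    [MeasurableSpace X] [BorelSpace X] (ψ : Flow ℝ X) : (flowInvProb ψ).Nonempty := by
  obtain ⟨x⟩ := ‹Nonempty X›
  let P (n : ℕ) : ProbabilityMeasure X :=
    ⟨orbitAverage ψ x n, isProbabilityMeasure_orbitAverage ψ x n⟩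
  let U : Ultrafilter ℕ := Ultrafilter.of atTop
  obtain ⟨m, -, hm⟩ := isCompact_univ.ultrafilter_le_nhds (U.map P) (by simp)
  have hlim : Tendsto P U (𝓝 m) := hm
  rw [ProbabilityMeasure.tendsto_iff_forall_integral_tendsto] at hlim
  refine ⟨m, ψ.mem_flowInvProb_of_integral_comp_eq m fun s f => ?_⟩
  have h₁ := hlim (f.compContinuous ⟨ψ s, ψ.continuous_toFun s⟩)
  have h₀ : Tendsto (fun n : ℕ => 2 * ‖f‖ * |s| * ((n : ℝ) + 1)⁻¹) U (𝓝 0) := by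
    have := (tendsto_one_div_add_atTop_nhds_zero_nat (𝕜 := ℝ)).const_mul (2 * ‖f‖ * |s|)
    simp only [one_div, mul_zero] at this
    exact this.mono_left (Ultrafilter.of_le _)
  have h₂ := squeeze_zero_norm
    (f := fun n => ∫ y, f (ψ s y) ∂(orbitAverage ψ x n) - ∫ y, f y ∂(orbitAverage ψ x n))
    (fun n => abs_integral_comp_flow_orbitAverage_sub_le ψ x n s f) h₀
  exact sub_eq_zero.1 (tendsto_nhds_unique (h₁.sub (hlim f)) h₂)

theorem bddAbove_integral_flowInvProb {X : Type*} [MetricSpace X] [CompactSpace X]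
    [MeasurableSpace X] [BorelSpace X] (ψ : Flow ℝ X) {f : X → ℝ} (hf : Continuous f) :
    BddAbove ((fun m : Measure X => ∫ x, f x ∂m) '' flowInvProb ψ) := by
  obtain ⟨C, hC⟩ := (isCompact_range hf).bddAbove
  refine ⟨C, ?_⟩
  rintro _ ⟨m, ⟨hm, -⟩, rfl⟩
  have hi : Integrable f m := hf.integrable_of_hasCompactSupport (.of_compactSpace f)
  simpa using integral_mono hi (integrable_const C) fun x => hC ⟨x, rfl⟩

/-- STATEMENT 9: if `r_0 ≡ 1` and `(r_s − 1)/s → ṙ₀` uniformly as `s → 0`, then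
`u(s) := sup_{m ∈ P(ψ)} ∫ r_s dm` satisfies `u(0) = 1` and has right derivative
`sup_{m ∈ P(ψ)} ∫ ṙ₀ dm` at `0`. -/
theorem right_deriv_sup_integral {X : Type*} [MetricSpace X] [CompactSpace X] [Nonempty X]
    [MeasurableSpace X] [BorelSpace X]
    (ψ : Flow ℝ X) (r : ℝ → X → ℝ) (rdot : X → ℝ)
    (hr_cont : ∀ s ∈ Set.Ioo (-1 : ℝ) 1, Continuous (r s))
    (hr0 : ∀ x : X, r 0 x = 1)
    (hrdot_cont : Continuous rdot)
    (hunif : ∀ ε > (0:ℝ), ∃ δ > (0:ℝ), ∀ s : ℝ, s ≠ 0 → |s| < δ →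
      ∀ x : X, |(r s x - 1) / s - rdot x| < ε) :
    sSup ((fun m : Measure X => ∫ x, r 0 x ∂m) '' flowInvProb ψ) = 1 ∧
      Tendsto
        (fun s : ℝ =>
          (sSup ((fun m : Measure X => ∫ x, r s x ∂m) '' flowInvProb ψ) - 1) / s)
        (𝓝[>] (0:ℝ))
        (𝓝 (sSup ((fun m : Measure X => ∫ x, rdot x ∂m) '' flowInvProb ψ))) := by
  have hne := flowInvProb_nonempty ψ
  have hint {f : X → ℝ} (hf : Continuous f) {m : Measure X} (hm : m ∈ flowInvProb ψ) :
      Integrable f m := by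
    have := hm.1
    exact hf.integrable_of_hasCompactSupport (.of_compactSpace f)
  constructor
  · have : (fun m : Measure X => ∫ x, r 0 x ∂m) '' flowInvProb ψ = {1} := by
      rw [← hne.image_const 1]
      refine Set.image_congr fun m hm => ?_
      have := hm.1
      simp [hr0]
    rw [this, csSup_singleton]
  · rw [Metric.tendsto_nhds]
    intro ε hε
    obtain ⟨δ, hδ, h⟩ := hunif (ε / 2) (half_pos hε)
    filter_upwards [Ioo_mem_nhdsGT (lt_min hδ one_pos)] with s hs
    obtain ⟨hs0, hs1⟩ := hs
    have hsδ : |s| < δ := by rw [abs_of_pos hs0]; exact hs1.trans_le (min_le_left _ _)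
    have hc : Continuous (r s) :=
      hr_cont s ⟨by linarith, hs1.trans_le (min_le_right _ _)⟩
    have key (m : Measure X) (hm : m ∈ flowInvProb ψ) :
        |(∫ x, r s x ∂m - 1) / s - ∫ x, rdot x ∂m| ≤ ε / 2 := by
      have := hm.1
      have e : (∫ x, r s x ∂m - 1) / s - ∫ x, rdot x ∂m =
          ∫ x, ((r s x - 1) / s - rdot x) ∂m := by
        have hq : Integrable (fun x => (r s x - 1) / s) m :=
          ((hint hc hm).sub (integrable_const 1)).div_const s
        rw [integral_sub hq (hint hrdot_cont hm), integral_div, integral_sub (hint hc hm) (integrable_const 1)]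
        simp
      rw [e]
      simpa using norm_integral_le_of_norm_le_const (μ := m)
        (f := fun x => (r s x - 1) / s - rdot x) (C := ε / 2)
        (.of_forall fun x => (h s hs0.ne' hsδ x).le)
    set A := sSup ((fun m : Measure X => ∫ x, r s x ∂m) '' flowInvProb ψ)
    set B := sSup ((fun m : Measure X => ∫ x, rdot x ∂m) '' flowInvProb ψ)
    have hA (m : Measure X) (hm : m ∈ flowInvProb ψ) : ∫ x, r s x ∂m ≤ A :=
      le_csSup (bddAbove_integral_flowInvProb ψ hc) ⟨m, hm, rfl⟩
    have hB (m : Measure X) (hm : m ∈ flowInvProb ψ) : ∫ x, rdot x ∂m ≤ B :=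
      le_csSup (bddAbove_integral_flowInvProb ψ hrdot_cont) ⟨m, hm, rfl⟩
    have hAB : A ≤ (B + ε / 2) * s + 1 := by
      refine csSup_le (hne.image _) ?_
      rintro _ ⟨m, hm, rfl⟩
      have h₁ : (∫ x, r s x ∂m - 1) / s ≤ B + ε / 2 := by
        linarith [(abs_le.1 (key m hm)).2, hB m hm]
      rw [div_le_iff₀ hs0] at h₁
      linarith
    have hBA : B ≤ (A - 1) / s + ε / 2 := by
      refine csSup_le (hne.image _) ?_
      rintro _ ⟨m, hm, rfl⟩
      have h₁ : (∫ x, r s x ∂m - 1) / s ≤ (A - 1) / s := by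
        gcongr
        exact hA m hm
      linarith [(abs_le.1 (key m hm)).1]
    have hAB' : (A - 1) / s ≤ B + ε / 2 := by
      rw [div_le_iff₀ hs0]
      linarith
    rw [Real.dist_eq, abs_lt]
    constructor <;> linarith
end
end
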